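/- Let x > 0 and let u : [0, x] → ℝ be a twice continuously differentiable function with u'(y) > 0 for all y ∈ [0, x], satisfying u''(y) = u(y)² on (0, x), u(0) = 0, and u(x) = 1. Then there exists ω > 0 such that, with Λ_ω = {m·(ω/√3)·e^{iπ/6} + n·(ω/√3)·e^{iπ/2} : m, n ∈ ℤ}, one has u(y) = 6·℘_{Λ_ω}(y + 2ω/3) for all y ∈ [0, x]; this ω satisfies the boundary condition 6·℘_{Λ_ω}(x + 2ω/3) = 1. -/

import Mathlib

open Set

/-- The Weierstrass ℘-function of the lattice `Λ`. -/
noncomputable def wp (Λ : Set ℂ) (z : ℂ) : ℂ :=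
  1 / z ^ 2 + ∑' l : {l : ℂ // l ∈ Λ ∧ l ≠ 0}, (1 / (z - (l : ℂ)) ^ 2 - 1 / (l : ℂ) ^ 2)

/-- The lattice `Λ_ω` generated by `(ω/√3) e^{iπ/6}` and `(ω/√3) e^{iπ/2}`. -/
noncomputable def Lomega (ω : ℝ) : Set ℂ :=
  {z : ℂ | ∃ m n : ℤ,
    z = (m : ℂ) * (((ω / Real.sqrt 3 : ℝ) : ℂ) * Complex.exp ((Real.pi : ℂ) * Complex.I / 6)) +
        (n : ℂ) * (((ω / Real.sqrt 3 : ℝ) : ℂ) * Complex.exp ((Real.pi : ℂ) * Complex.I / 2))}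

open Complex PeriodPair Filter Topology

/-- square root of three -/
noncomputable def s3 : ℂ := ((Real.sqrt 3 : ℝ) : ℂ)

lemma s3_sq : s3 ^ 2 = 3 := by
  unfold s3
  rw [← Complex.ofReal_pow, Real.sq_sqrt (by norm_num)]
  norm_num

lemma s3_conj : (starRingEnd ℂ) s3 = s3 := by
  unfold s3; exact Complex.conj_ofReal _

/-- the hexagonal period pair -/
noncomputable def HL : PeriodPair where
  ω₁ := 1 / 2 + s3 / 6 * I
  ω₂ := s3 / 3 * I
  indep := by
    rw [LinearIndependent.pair_iff]
    intro a b h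
    have hs : 0 < Real.sqrt 3 := by positivity
    have h1 := congrArg Complex.re h
    have h2 := congrArg Complex.im h
    simp [s3] at h1 h2
    subst h1
    simp at h2
    exact ⟨rfl, h2⟩

lemma HL_mem {z : ℂ} : z ∈ HL.lattice ↔
    ∃ m n : ℤ, (m : ℂ) * (1 / 2 + s3 / 6 * I) + n * (s3 / 3 * I) = z :=
  PeriodPair.mem_lattice

/-- cube root of unity -/
noncomputable def rho : ℂ := -1 / 2 + s3 / 2 * I

lemma rho_cube : rho ^ 3 = 1 := by
  unfold rho
  linear_combination (3/8 : ℂ) * s3_sq + (-3/8 * s3^2 + s3^3 / 8 * I) * I_sq + (-1/8 * s3 * I) * s3_sq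

lemma rho_mem {z : ℂ} (hz : z ∈ HL.lattice) : rho * z ∈ HL.lattice := by
  rw [HL_mem] at hz ⊢
  obtain ⟨m, n, rfl⟩ := hz
  refine ⟨-m - n, m, ?_⟩
  have := s3_sq
  unfold rho
  push_cast
  linear_combination (-(m:ℂ)/12 - n / 6) * s3^2 * I_sq + ((m:ℂ)/12 + n/6) * s3_sq

lemma rho_ne_zero : rho ≠ 0 := by
  intro h
  have := rho_cube
  simp [h] at this

lemma rho_ne_one : rho ≠ 1 := by
  intro h
  have := congrArg Complex.re h
  simp [rho, s3] at this
  norm_num at this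

lemma rho_inv_eq {z : ℂ} : rho * (rho * (rho * z)) = z := by
  linear_combination z * rho_cube

/-- rotation of the lattice -/
noncomputable def rotE : HL.lattice ≃ HL.lattice where
  toFun l := ⟨rho * l, rho_mem l.2⟩
  invFun l := ⟨rho * (rho * l), rho_mem (rho_mem l.2)⟩
  left_inv _ := Subtype.ext rho_inv_eq
  right_inv _ := Subtype.ext rho_inv_eq

lemma conj_mem {z : ℂ} (hz : z ∈ HL.lattice) : (starRingEnd ℂ) z ∈ HL.lattice := by
  rw [HL_mem] at hz ⊢
  obtain ⟨m, n, rfl⟩ := hz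
  refine ⟨m, -m - n, ?_⟩
  have c2 : (starRingEnd ℂ) 2 = 2 := Complex.conj_ofNat 2
  have c3 : (starRingEnd ℂ) 3 = 3 := Complex.conj_ofNat 3
  have c6 : (starRingEnd ℂ) 6 = 6 := Complex.conj_ofNat 6
  simp [s3_conj, c2, c3, c6]
  ring

/-- conjugation of the lattice -/
noncomputable def conjE : HL.lattice ≃ HL.lattice where
  toFun l := ⟨(starRingEnd ℂ) l, conj_mem l.2⟩
  invFun l := ⟨(starRingEnd ℂ) l, conj_mem l.2⟩
  left_inv _ := Subtype.ext (by simp)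
  right_inv _ := Subtype.ext (by simp)

lemma HL_g2 : HL.g₂ = 0 := by
  have h : HL.G 4 = (rho ^ 4)⁻¹ * HL.G 4 := by
    conv_lhs => rw [PeriodPair.G, ← rotE.tsum_eq]
    rw [PeriodPair.G, ← tsum_mul_left]
    congr with l
    simp [rotE, mul_pow, mul_comm]
  have h4 : rho ^ 4 = rho := by linear_combination rho * rho_cube
  rw [h4] at h
  have h5 : (rho - 1) * HL.G 4 = 0 := by
    have := rho_ne_zero
    field_simp at h
    linear_combination h
  rcases mul_eq_zero.1 h5 with h6 | h6
  · exact absurd (sub_eq_zero.1 h6) rho_ne_one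
  · simp [PeriodPair.g₂, h6]

lemma HL_rot (z : ℂ) : HL.weierstrassP (rho * z) = rho * HL.weierstrassP z := by
  conv_lhs => rw [PeriodPair.weierstrassP, ← rotE.tsum_eq]
  rw [PeriodPair.weierstrassP, ← tsum_mul_left]
  congr with l
  have h2 : (rho ^ 2)⁻¹ = rho := by
    rw [inv_eq_iff_eq_inv, eq_comm, inv_eq_iff_eq_inv]
    exact eq_inv_of_mul_eq_one_left (by linear_combination rho_cube)
  simp only [rotE, Equiv.coe_fn_mk, ← mul_sub, mul_pow, one_div, mul_inv, h2]

lemma HL_conj (z : ℂ) :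
    HL.weierstrassP ((starRingEnd ℂ) z) = (starRingEnd ℂ) (HL.weierstrassP z) := by
  conv_lhs => rw [PeriodPair.weierstrassP, ← conjE.tsum_eq]
  rw [PeriodPair.weierstrassP, Complex.conj_tsum]
  congr with l
  simp [conjE]

lemma HL_real (t : ℝ) : ((HL.weierstrassP t).re : ℂ) = HL.weierstrassP t := by
  have := HL_conj (t : ℂ)
  rw [Complex.conj_ofReal] at this
  exact Complex.conj_eq_iff_re.1 this.symm

lemma one_mem : (1 : ℂ) ∈ HL.lattice := by
  rw [HL_mem]
  exact ⟨2, -1, by push_cast; ring⟩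

lemma HL_sub (z : ℂ) : HL.weierstrassP (1 - z) = HL.weierstrassP z := by
  rw [← HL.weierstrassP_neg, neg_sub]
  exact HL.weierstrassP_sub_coe z ⟨1, one_mem⟩

lemma HL_deriv_half : HL.derivWeierstrassP ((1 / 2 : ℝ) : ℂ) = 0 := by
  have h := HL.derivWeierstrassP_neg ((1 / 2 : ℝ) : ℂ)
  have h2 := HL.derivWeierstrassP_sub_coe ((1 / 2 : ℝ) : ℂ) ⟨1, one_mem⟩
  have h3 : ((1 / 2 : ℝ) : ℂ) - 1 = -((1 / 2 : ℝ) : ℂ) := by push_cast; ring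
  simp only [h3] at h2
  rw [h2] at h
  exact CharZero.eq_neg_self_iff.1 h

lemma HL_third : HL.weierstrassP ((2 / 3 : ℝ) : ℂ) = 0 := by
  have hz : HL.weierstrassP (1/3 : ℂ) = 0 := by
    have hm : (-1/2 + s3 / 6 * I : ℂ) ∈ HL.lattice := by
      rw [HL_mem]
      exact ⟨-1, 1, by push_cast; ring⟩
    have h1 := HL.weierstrassP_add_coe (1/3) ⟨_, hm⟩
    have h2 : (1/3 : ℂ) + (-1/2 + s3 / 6 * I) = rho * (1/3) := by unfold rho; ring
    simp only [h2, HL_rot] at h1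
    have h3 : (rho - 1) * HL.weierstrassP (1/3 : ℂ) = 0 := by linear_combination h1
    exact (mul_eq_zero.1 h3).resolve_left (sub_ne_zero.2 rho_ne_one)
  rw [← HL_sub]
  convert hz using 2
  push_cast; ring

lemma notMem (t : ℝ) (h0 : 0 < t) (h1 : t < 1) : (t : ℂ) ∉ HL.lattice := by
  rw [HL_mem]
  rintro ⟨m, n, h⟩
  have hs : 0 < Real.sqrt 3 := by positivity
  have hr := congrArg Complex.re h
  have hi := congrArg Complex.im h
  simp [s3] at hr hi
  have h3 : Real.sqrt 3 * ((m : ℝ) + 2 * n) = 0 := by linarith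
  have h4 : (m : ℝ) + 2 * n = 0 := (mul_eq_zero.1 h3).resolve_left hs.ne'
  have h5 : t = ((-n : ℤ) : ℝ) := by push_cast; linarith
  rw [h5] at h0 h1
  have h6 : (0 : ℤ) < -n := by exact_mod_cast h0
  have h7 : -n < (1 : ℤ) := by exact_mod_cast h1
  omega

lemma HL_hasDeriv {z : ℂ} (hz : z ∉ HL.lattice) :
    HasDerivAt HL.weierstrassP (HL.derivWeierstrassP z) z := by
  have := (HL.analyticOnNhd_weierstrassP z hz).differentiableAt.hasDerivAt
  rwa [HL.deriv_weierstrassP] at this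

lemma HL_second {z : ℂ} (hz : z ∉ HL.lattice) :
    HasDerivAt HL.derivWeierstrassP (6 * HL.weierstrassP z ^ 2) z := by
  have hopen : IsOpen ((HL.lattice : Set ℂ)ᶜ) := HL.isClosed_lattice.isOpen_compl
  have hconn : IsPreconnected ((HL.lattice : Set ℂ)ᶜ) := by
    refine (Set.Countable.isConnected_compl_of_one_lt_rank (by simp) ?_).2
    have : Countable HL.lattice := HL.latticeEquivProd.toEquiv.countable_iff.2 inferInstance
    exact Set.to_countable _
  have key := AnalyticOnNhd.eq_zero_or_eq_zero_of_mul_eq_zero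
    (f := HL.derivWeierstrassP)
    (g := fun z => deriv HL.derivWeierstrassP z - 6 * HL.weierstrassP z ^ 2)
    HL.analyticOnNhd_derivWeierstrassP
    (HL.analyticOnNhd_derivWeierstrassP.deriv.sub
      (analyticOnNhd_const.mul (HL.analyticOnNhd_weierstrassP.pow 2))) ?_ hconn
  · rcases key with h | h
    · exfalso
      have hc : ContinuousAt (fun z => HL.derivWeierstrassPExcept 0 z * z ^ 3) 0 :=
        (HL.analyticAt_derivWeierstrassPExcept 0).continuousAt.mul (by fun_prop)
      have ht : Tendsto (fun z => HL.derivWeierstrassPExcept 0 z * z ^ 3) (𝓝[≠] 0) (𝓝 0) := by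
        have := hc.tendsto
        simp only [ne_eq, OfNat.ofNat_ne_zero, not_false_eq_true, zero_pow, mul_zero] at this
        exact this.mono_left nhdsWithin_le_nhds
      have he : (fun z => HL.derivWeierstrassPExcept 0 z * z ^ 3) =ᶠ[𝓝[≠] 0] fun _ => (2 : ℂ) := by
        filter_upwards [self_mem_nhdsWithin, mem_nhdsWithin_of_mem_nhds
          (HL.compl_lattice_sdiff_singleton_mem_nhds 0)] with w hw hw2
        have hw' : w ∉ HL.lattice := fun hm => hw2 ⟨hm, hw⟩
        have h1 := HL.derivWeierstrassPExcept_sub 0 w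
        have hw0 : w ≠ 0 := hw
        have h2 : HL.derivWeierstrassP w = 0 := h w hw'
        rw [h2] at h1
        simp only [ZeroMemClass.coe_zero, sub_zero] at h1
        rw [sub_eq_zero.1 h1]
        field_simp
      have := tendsto_nhds_unique (ht.congr' he) tendsto_const_nhds
      norm_num at this
    · have h1 := (HL.analyticOnNhd_derivWeierstrassP z hz).differentiableAt.hasDerivAt
      have h2 := h z hz
      simp only [sub_eq_zero] at h2
      rwa [h2] at h1
  · intro w hw
    have hd1 := (HL.analyticOnNhd_derivWeierstrassP w hw).differentiableAt.hasDerivAt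
    have hd0 := HL_hasDeriv hw
    have he : (fun z => HL.derivWeierstrassP z ^ 2) =ᶠ[𝓝 w]
        fun z => 4 * HL.weierstrassP z ^ 3 - HL.g₃ := by
      filter_upwards [hopen.mem_nhds hw] with v hv
      have := HL.derivWeierstrassP_sq v hv
      rw [this, HL_g2]; ring
    have e1 := (hd1.pow 2)
    have e2 := (((hd0.pow 3).const_mul 4).sub_const HL.g₃).congr_of_eventuallyEq he
    have e3 := e1.unique e2
    norm_num at e3
    show HL.derivWeierstrassP w * (deriv HL.derivWeierstrassP w - 6 * HL.weierstrassP w ^ 2) = 0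
    linear_combination e3 / 2

/-- real Weierstrass function -/
noncomputable def RP (t : ℝ) : ℝ := (HL.weierstrassP t).re
/-- its derivative -/
noncomputable def RP' (t : ℝ) : ℝ := (HL.derivWeierstrassP t).re

lemma RP_deriv {t : ℝ} (h0 : 0 < t) (h1 : t < 1) : HasDerivAt RP (RP' t) t :=
  (HL_hasDeriv (notMem t h0 h1)).real_of_complex

lemma RP'_deriv {t : ℝ} (h0 : 0 < t) (h1 : t < 1) : HasDerivAt RP' (6 * RP t ^ 2) t := by
  have := (HL_second (notMem t h0 h1)).real_of_complex
  rw [← HL_real t] at this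
  have h2 : (6 * (((HL.weierstrassP t).re : ℝ) : ℂ) ^ 2).re = 6 * RP t ^ 2 := by
    unfold RP
    norm_cast
  rw [h2] at this
  exact this

lemma RP_third : RP (2 / 3) = 0 := by
  unfold RP; rw [HL_third]; rfl

lemma RP'_third : 0 ≤ RP' (2 / 3) := by
  have h : RP' (1 / 2) = 0 := by unfold RP'; rw [HL_deriv_half]; rfl
  rw [← h]
  have : MonotoneOn RP' (Icc (1/2) (2/3)) := by
    apply monotoneOn_of_deriv_nonneg (convex_Icc _ _)
    · intro t ht
      exact (RP'_deriv (by linarith [ht.1]) (by linarith [ht.2])).continuousAt.continuousWithinAt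
    · intro t ht
      rw [interior_Icc] at ht
      exact (RP'_deriv (by linarith [ht.1]) (by linarith [ht.2])).differentiableAt.differentiableWithinAt
    · intro t ht
      rw [interior_Icc] at ht
      rw [(RP'_deriv (by linarith [ht.1]) (by linarith [ht.2])).deriv]
      positivity
  exact this (by constructor <;> norm_num) (by constructor <;> norm_num) (by norm_num)

lemma RP_tendsto : Tendsto RP (𝓝[<] 1) atTop := by
  have h0 : Tendsto RP (𝓝[>] 0) atTop := by
    have he : ∀ t : ℝ, RP t = (HL.weierstrassPExcept 0 t).re + (t ^ 2)⁻¹ := by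
      intro t
      have := HL.weierstrassPExcept_add 0 t
      unfold RP
      rw [← this]
      simp only [ZeroMemClass.coe_zero, sub_zero]
      rw [Complex.add_re]
      congr 1
      rw [← Complex.ofReal_re ((t ^ 2)⁻¹)]
      congr 1
      push_cast
      simp
    have hc : ContinuousAt (fun t : ℝ => (HL.weierstrassPExcept 0 t).re) 0 := by
      have h1 : ContinuousAt (HL.weierstrassPExcept 0) ((0 : ℝ) : ℂ) := by
        rw [Complex.ofReal_zero]
        exact (HL.analyticAt_weierstrassPExcept 0).continuousAt
      exact Complex.continuous_re.continuousAt.comp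
        (ContinuousAt.comp (f := fun t : ℝ => (t : ℂ)) h1 Complex.continuous_ofReal.continuousAt)
    rw [funext he]
    refine (hc.tendsto.mono_left nhdsWithin_le_nhds).add_atTop ?_
    refine tendsto_inv_nhdsGT_zero.comp ?_
    refine tendsto_nhdsWithin_iff.2 ⟨?_, ?_⟩
    · have : ContinuousAt (fun t : ℝ => t ^ 2) 0 := by fun_prop
      have := this.tendsto
      simp only [ne_eq, OfNat.ofNat_ne_zero, not_false_eq_true, zero_pow] at this
      exact this.mono_left nhdsWithin_le_nhds
    · filter_upwards [self_mem_nhdsWithin] with t ht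
      exact pow_pos (Set.mem_Ioi.1 ht) 2
  have h1 : Tendsto (fun t : ℝ => 1 - t) (𝓝[<] 1) (𝓝[>] 0) := by
    refine tendsto_nhdsWithin_iff.2 ⟨?_, ?_⟩
    · have : ContinuousAt (fun t : ℝ => 1 - t) 1 := by fun_prop
      have := this.tendsto
      simp only [sub_self] at this
      exact this.mono_left nhdsWithin_le_nhds
    · filter_upwards [self_mem_nhdsWithin] with t ht
      exact sub_pos.2 (Set.mem_Iio.1 ht)
  refine (h0.comp h1).congr fun t => ?_
  simp only [Function.comp, RP]
  push_cast
  rw [HL_sub]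

lemma ode_unique {T : ℝ} {a a' b b' : ℝ → ℝ}
    (ha : ∀ y ∈ Icc 0 T, HasDerivWithinAt a (a' y) (Icc 0 T) y)
    (ha' : ∀ y ∈ Icc 0 T, HasDerivWithinAt a' (a y ^ 2) (Icc 0 T) y)
    (hb : ∀ y ∈ Icc 0 T, HasDerivWithinAt b (b' y) (Icc 0 T) y)
    (hb' : ∀ y ∈ Icc 0 T, HasDerivWithinAt b' (b y ^ 2) (Icc 0 T) y)
    (h0 : a 0 = b 0) (h0' : a' 0 = b' 0) : ∀ y ∈ Icc 0 T, a y = b y := by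
  have hac : ContinuousOn a (Icc 0 T) := fun y hy => (ha y hy).continuousWithinAt
  have hbc : ContinuousOn b (Icc 0 T) := fun y hy => (hb y hy).continuousWithinAt
  obtain ⟨A, hA⟩ := isCompact_Icc.exists_bound_of_continuousOn hac
  obtain ⟨B, hB⟩ := isCompact_Icc.exists_bound_of_continuousOn hbc
  have hmono : ∀ {f : ℝ → ℝ} {f' : ℝ} {t : ℝ}, t ∈ Ico 0 T →
      HasDerivWithinAt f f' (Icc 0 T) t → HasDerivWithinAt f f' (Ici t) t := by
    intro f f' t ht h
    refine h.mono_of_mem_nhdsWithin ?_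
    exact mem_of_superset (Icc_mem_nhdsGE ht.2) (Icc_subset_Icc_left ht.1)
  set M : ℝ := max 0 (max A B) with hM
  have hM0 : 0 ≤ M := le_max_left _ _
  have hAM : A ≤ M := (le_max_left _ _).trans (le_max_right _ _)
  have hBM : B ≤ M := (le_max_right _ _).trans (le_max_right _ _)
  have key := ODE_solution_unique_of_mem_Icc_right
    (v := fun _ (p : ℝ × ℝ) => (p.2, p.1 ^ 2)) (s := fun _ => {p : ℝ × ℝ | |p.1| ≤ M})
    (K := NNReal.mk (max 1 (2 * M)) (by positivity)) (a := 0) (b := T)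
    (f := fun t => (a t, a' t)) (g := fun t => (b t, b' t))
    ?_ ?_ ?_ ?_ ?_ ?_ ?_ ?_
  · intro y hy
    exact congrArg Prod.fst (key hy)
  · intro t _
    refine LipschitzOnWith.of_dist_le_mul ?_
    intro p hp q hq
    simp only [Set.mem_ofPred_eq] at hp hq
    rw [Prod.dist_eq, Prod.dist_eq, NNReal.coe_mk]
    have h1 : (1 : ℝ) ≤ max 1 (2 * M) := le_max_left _ _
    have h2 : 2 * M ≤ max 1 (2 * M) := le_max_right _ _
    have hm : 0 ≤ max (dist p.1 q.1) (dist p.2 q.2) := dist_nonneg.trans (le_max_left _ _)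
    refine max_le ?_ ?_
    · calc dist p.2 q.2 ≤ max (dist p.1 q.1) (dist p.2 q.2) := le_max_right _ _
        _ ≤ _ := le_mul_of_one_le_left hm h1
    · have h3 : dist (p.1 ^ 2) (q.1 ^ 2) = |p.1 + q.1| * dist p.1 q.1 := by
        rw [Real.dist_eq, Real.dist_eq, ← abs_mul]; ring_nf
      show dist (p.1 ^ 2) (q.1 ^ 2) ≤ _
      rw [h3]
      have h4 : |p.1 + q.1| ≤ max 1 (2 * M) := by
        have := abs_add_le p.1 q.1
        linarith
      exact mul_le_mul h4 (le_max_left _ _) dist_nonneg (by positivity)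
  · exact hac.prodMk fun y hy => (ha' y hy).continuousWithinAt
  · intro t ht
    exact (hmono ht (ha t ⟨ht.1, ht.2.le⟩)).prodMk (hmono ht (ha' t ⟨ht.1, ht.2.le⟩))
  · intro t ht
    exact (hA t ⟨ht.1, ht.2.le⟩).trans hAM
  · exact hbc.prodMk fun y hy => (hb' y hy).continuousWithinAt
  · intro t ht
    exact (hmono ht (hb t ⟨ht.1, ht.2.le⟩)).prodMk (hmono ht (hb' t ⟨ht.1, ht.2.le⟩))
  · intro t ht
    exact (hB t ⟨ht.1, ht.2.le⟩).trans hBM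
  · simp [h0, h0']

lemma RP'_pos : 0 < RP' (2 / 3) := by
  refine lt_of_le_of_ne RP'_third fun h => ?_
  have hz : ∀ t, 2 / 3 < t → t < 1 → RP t = 0 := by
    intro t h1 h2
    have key := ode_unique (T := t - 2 / 3) (a := fun y => 6 * RP (y + 2 / 3))
      (a' := fun y => 6 * RP' (y + 2 / 3)) (b := fun _ => 0) (b' := fun _ => 0)
      ?_ ?_ ?_ ?_ ?_ ?_ (t - 2 / 3) ⟨by linarith, le_rfl⟩
    · simpa using key
    · intro y hy
      have := (RP_deriv (t := y + 2 / 3) (by linarith [hy.1]) (by linarith [hy.2])).comp_add_const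
      exact (this.const_mul 6).hasDerivWithinAt
    · intro y hy
      have := (RP'_deriv (t := y + 2 / 3) (by linarith [hy.1]) (by linarith [hy.2])).comp_add_const
      refine HasDerivAt.hasDerivWithinAt ((this.const_mul 6).congr_deriv ?_)
      ring
    · intro y _; exact hasDerivWithinAt_const _ _ _
    · intro y _; simpa using hasDerivWithinAt_const y (Icc 0 (t - 2 / 3)) (0 : ℝ)
    · simp [RP_third]
    · simp [← h]
  have hI : Ioo (2 / 3 : ℝ) 1 ∈ 𝓝[<] (1 : ℝ) := Ioo_mem_nhdsLT (by norm_num)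
  obtain ⟨t, ht, ht2⟩ := ((RP_tendsto.eventually_ge_atTop 1).and hI).exists
  rw [hz t ht2.1 ht2.2] at ht
  norm_num at ht

lemma Lomega_mem {ω : ℝ} {l : ℂ} : l ∈ Lomega ω ↔ ∃ k ∈ HL.lattice, l = ω * k := by
  have hs := s3_sq
  have hs0 : s3 ≠ 0 := by intro h; simp [h] at hs
  have e1 : Complex.exp ((Real.pi : ℂ) * Complex.I / 6) = s3 / 2 + 1 / 2 * I := by
    have : (Real.pi : ℂ) * Complex.I / 6 = ((Real.pi / 6 : ℝ) : ℂ) * I := by push_cast; ring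
    rw [this, Complex.exp_mul_I, ← Complex.ofReal_cos, ← Complex.ofReal_sin, Real.cos_pi_div_six,
      Real.sin_pi_div_six]
    unfold s3
    push_cast; ring
  have e2 : Complex.exp ((Real.pi : ℂ) * Complex.I / 2) = I := by
    have : (Real.pi : ℂ) * Complex.I / 2 = (Real.pi : ℂ) / 2 * I := by ring
    rw [this, Complex.exp_pi_div_two_mul_I]
  have e3 : ((ω / Real.sqrt 3 : ℝ) : ℂ) = ω * s3 / 3 := by
    push_cast
    change (ω : ℂ) / s3 = _
    field_simp
    linear_combination -(ω : ℂ) * hs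
  unfold Lomega
  simp only [Set.mem_ofPred_eq, HL_mem, e1, e2, e3]
  constructor
  · rintro ⟨m, n, rfl⟩
    refine ⟨_, ⟨m, n, rfl⟩, ?_⟩
    linear_combination (m * ω / 6 : ℂ) * hs
  · rintro ⟨k, ⟨m, n, rfl⟩, rfl⟩
    refine ⟨m, n, ?_⟩
    linear_combination -(m * ω / 6 : ℂ) * hs

lemma wp_scale {ω : ℝ} (hω : 0 < ω) (z : ℂ) :
    wp (Lomega ω) (ω * z) = ((ω : ℂ) ^ 2)⁻¹ * HL.weierstrassP z := by
  have hw : (ω : ℂ) ≠ 0 := by exact_mod_cast hω.ne'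
  have hmem : ∀ l : {l : ℂ // l ∈ Lomega ω ∧ l ≠ 0}, (l : ℂ) / ω ∈ HL.lattice := by
    rintro ⟨l, h1, h2⟩
    obtain ⟨k, hk, rfl⟩ := Lomega_mem.1 h1
    simpa [mul_div_cancel_left₀ _ hw] using hk
  let g : {l : ℂ // l ∈ Lomega ω ∧ l ≠ 0} → HL.lattice := fun l => ⟨(l : ℂ) / ω, hmem l⟩
  have hg : Function.Injective g := by
    intro a b hab
    have : (a : ℂ) / ω = b / ω := congrArg Subtype.val hab
    exact Subtype.ext ((div_left_inj' hw).1 this)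
  have h1 := HL.weierstrassPExcept_add 0 z
  rw [← h1, PeriodPair.weierstrassPExcept, ← hg.tsum_eq]
  · unfold wp
    rw [mul_add, ← tsum_mul_left, add_comm]
    congr 1
    · congr with l
      have hl : (l : ℂ) ≠ 0 := l.2.2
      have hgl : ((g l : HL.lattice) : ℂ) = l / ω := rfl
      have h0 : ((g l : HL.lattice) : ℂ) ≠ ((0 : HL.lattice) : ℂ) := by
        rw [hgl]; simp [hl, hw]
      rw [if_neg h0, hgl]
      have h3 : (ω : ℂ) * z - l = ω * (z - l / ω) := by field_simp
      have h4 : (l : ℂ) ^ 2 = ω ^ 2 * (l / ω) ^ 2 := by field_simp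
      rw [h3, h4, mul_pow]
      simp only [one_div, mul_inv]
      ring
    · simp [mul_pow, mul_comm]
  · intro k hk
    have hk0 : (k : ℂ) ≠ 0 := by
      intro h
      have h' : k = 0 := Subtype.ext h
      simp [h'] at hk
    refine ⟨⟨ω * k, Lomega_mem.2 ⟨k, k.2, rfl⟩, mul_ne_zero hw hk0⟩, ?_⟩
    apply Subtype.ext
    simp [g, mul_div_cancel_left₀ _ hw]


/-- Any twice continuously differentiable solution of `u'' = u²`, `u(0) = 0`, `u(x) = 1`
with strictly positive derivative is of the form `u(y) = 6 ℘_{Λ_ω}(y + 2ω/3)` for some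
`ω > 0` satisfying the boundary condition `6 ℘_{Λ_ω}(x + 2ω/3) = 1`. -/
theorem wstrs_representation
    (x : ℝ) (hx : 0 < x) (u u' u'' : ℝ → ℝ)
    (hu' : ∀ y ∈ Icc 0 x, HasDerivWithinAt u (u' y) (Icc 0 x) y)
    (hu'' : ∀ y ∈ Icc 0 x, HasDerivWithinAt u' (u'' y) (Icc 0 x) y)
    (hcont : ContinuousOn u'' (Icc 0 x))
    (hpos : ∀ y ∈ Icc 0 x, 0 < u' y)
    (hode : ∀ y ∈ Ioo 0 x, u'' y = (u y) ^ 2)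
    (h0 : u 0 = 0) (hx1 : u x = 1) :
    ∃ ω : ℝ, 0 < ω ∧
      (∀ y ∈ Icc 0 x, ((u y : ℂ)) = 6 * wp (Lomega ω) ((y : ℂ) + 2 * (ω : ℂ) / 3)) ∧
      6 * wp (Lomega ω) ((x : ℂ) + 2 * (ω : ℂ) / 3) = 1 := by
  have hx0 : (0 : ℝ) ∈ Icc 0 x := ⟨le_rfl, hx.le⟩
  have hc := RP'_pos
  have hd : 0 < u' 0 := hpos 0 hx0
  obtain ⟨ω, hω, hω3⟩ : ∃ ω : ℝ, 0 < ω ∧ u' 0 * ω ^ 3 = 6 * RP' (2 / 3) := by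
    have hq : 0 ≤ 6 * RP' (2 / 3) / u' 0 := by positivity
    refine ⟨(6 * RP' (2 / 3) / u' 0) ^ ((3 : ℕ) : ℝ)⁻¹, by positivity, ?_⟩
    rw [Real.rpow_inv_natCast_pow hq (by norm_num)]
    field_simp
  have hu2 : ∀ y ∈ Icc 0 x, u'' y = u y ^ 2 := by
    have hcu : ContinuousOn (fun y => u y ^ 2) (Icc 0 x) := fun y hy =>
      (hu' y hy).continuousWithinAt.pow 2
    have : EqOn u'' (fun y => u y ^ 2) (Icc 0 x) := by
      refine EqOn.of_subset_closure (s := Ioo 0 x) hode hcont hcu Ioo_subset_Icc_self ?_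
      rw [closure_Ioo hx.ne]
    exact this
  have hpt : ∀ y, 0 ≤ y → y < ω / 3 → 0 < y / ω + 2 / 3 ∧ y / ω + 2 / 3 < 1 := by
    intro y h1 h2
    have h3 : y / ω < 1 / 3 := by rw [div_lt_iff₀ hω]; linarith
    have h4 : 0 ≤ y / ω := by positivity
    constructor <;> linarith
  have huv : ∀ y ∈ Icc 0 x, y < ω / 3 → u y = 6 * RP (y / ω + 2 / 3) / ω ^ 2 := by
    intro y hy hyw
    have hsub : Icc 0 y ⊆ Icc 0 x := Icc_subset_Icc_right hy.2
    have hin : ∀ t : ℝ, HasDerivAt (fun y : ℝ => y / ω + 2 / 3) (1 / ω) t := fun t =>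
      ((hasDerivAt_id t).div_const ω).add_const _
    refine ode_unique (T := y) (a := u) (a' := u') (b := fun y => 6 * RP (y / ω + 2 / 3) / ω ^ 2)
      (b' := fun y => 6 * RP' (y / ω + 2 / 3) / ω ^ 3) ?_ ?_ ?_ ?_ ?_ ?_ y ⟨hy.1, le_rfl⟩
    · intro t ht; exact (hu' t (hsub ht)).mono hsub
    · intro t ht
      rw [← hu2 t (hsub ht)]
      exact (hu'' t (hsub ht)).mono hsub
    · intro t ht
      obtain ⟨p1, p2⟩ := hpt t ht.1 (ht.2.trans_lt hyw)
      have := (((RP_deriv p1 p2).comp t (hin t)).const_mul 6).div_const (ω ^ 2)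
      refine HasDerivAt.hasDerivWithinAt (this.congr_deriv ?_)
      field_simp
    · intro t ht
      obtain ⟨p1, p2⟩ := hpt t ht.1 (ht.2.trans_lt hyw)
      have := (((RP'_deriv p1 p2).comp t (hin t)).const_mul 6).div_const (ω ^ 3)
      refine HasDerivAt.hasDerivWithinAt (this.congr_deriv ?_)
      field_simp
    · simp [h0, RP_third]
    · simp only [zero_div, zero_add]
      rw [← hω3]
      field_simp
  have hxω : x < ω / 3 := by
    by_contra hcon
    push Not at hcon
    obtain ⟨B, hB⟩ := isCompact_Icc.exists_bound_of_continuousOn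
      (fun y hy => (hu' y hy).continuousWithinAt : ContinuousOn u (Icc 0 x))
    have hI : Ioo (2 / 3 : ℝ) 1 ∈ 𝓝[<] (1 : ℝ) := Ioo_mem_nhdsLT (by norm_num)
    obtain ⟨t, ht, ht2⟩ := ((RP_tendsto.eventually_gt_atTop (B * ω ^ 2 / 6)).and hI).exists
    have q1 : 0 ≤ (t - 2 / 3) * ω := mul_nonneg (by linarith [ht2.1]) hω.le
    have q2 : (t - 2 / 3) * ω < ω / 3 := by nlinarith [ht2.2]
    have q3 : (t - 2 / 3) * ω ∈ Icc 0 x := ⟨q1, by linarith⟩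
    have q4 := huv _ q3 q2
    have q5 : (t - 2 / 3) * ω / ω + 2 / 3 = t := by field_simp; ring
    rw [q5] at q4
    have q6 := (le_abs_self _).trans (hB _ q3)
    rw [q4, div_le_iff₀ (by positivity)] at q6
    linarith
  have hfin : ∀ y ∈ Icc 0 x, ((u y : ℂ)) = 6 * wp (Lomega ω) ((y : ℂ) + 2 * (ω : ℂ) / 3) := by
    intro y hy
    have hw : (ω : ℂ) ≠ 0 := by exact_mod_cast hω.ne'
    have harg : (y : ℂ) + 2 * (ω : ℂ) / 3 = ω * ((y / ω + 2 / 3 : ℝ) : ℂ) := by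
      push_cast; field_simp
    rw [harg, wp_scale hω, huv y hy (hy.2.trans_lt hxω), ← HL_real]
    unfold RP
    push_cast
    ring
  refine ⟨ω, hω, hfin, ?_⟩
  rw [← hfin x ⟨hx.le, le_rfl⟩, hx1]
  simp
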